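/- arXiv:2512.00570 — 5 statements merged into one kernel-verified Lean document; each statement's English description precedes it below -/
import Mathlib

section
/- Magic formula for so(N): for every N ≥ 2, every orthonormal basis (v_α)_{α=1, …, N(N−1)/2} of so(N) with respect to the inner product ⟨X, Y⟩ = Tr(X Yᵀ), and every real N×N matrix M, one has Σ_α v_α M v_α = (1/2) Mᵀ − (1/2) Tr(M) I_N. In particular (taking M = I_N), Σ_α v_α² = −((N−1)/2) I_N. -/
open Matrix

/-- An element of the span of a family orthonormal for `Tr (X Yᵀ)` is the sum of its
projections. -/
lemma eq_sum_trace_smul_of_mem_span {ι n : Type*} [Fintype ι] [DecidableEq ι] [Fintype n]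
    {v : ι → Matrix n n ℝ}
    (horth : ∀ α β, Matrix.trace (v α * (v β)ᵀ) = if α = β then 1 else 0)
    {X : Matrix n n ℝ} (hX : X ∈ Submodule.span ℝ (Set.range v)) :
    X = ∑ α, Matrix.trace (X * (v α)ᵀ) • v α := by
  obtain ⟨c, rfl⟩ := (Submodule.mem_span_range_iff_exists_fun ℝ).1 hX
  refine Finset.sum_congr rfl fun β _ => ?_
  simp [Finset.sum_mul, Matrix.trace_sum, horth]

/-- Completeness relation for an orthonormal basis of the skew-symmetric matrices. -/
lemma sum_apply_mul_apply_of_orthonormal_skew {ι n : Type*} [Fintype ι] [DecidableEq ι]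
    [Fintype n] [DecidableEq n] {v : ι → Matrix n n ℝ}
    (hskew : ∀ α, (v α)ᵀ = -(v α))
    (horth : ∀ α β, Matrix.trace (v α * (v β)ᵀ) = if α = β then 1 else 0)
    (hspan : ∀ X : Matrix n n ℝ, Xᵀ = -X → X ∈ Submodule.span ℝ (Set.range v))
    (i j k l : n) :
    ∑ α, v α i j * v α k l =
      (1 / 2) * ((if i = k ∧ j = l then 1 else 0) - if j = k ∧ i = l then 1 else 0) := by
  have hX := eq_sum_trace_smul_of_mem_span horth
    (hspan (Matrix.single i j 1 - Matrix.single j i 1) (by simp))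
  have htr (α : ι) : Matrix.trace
      ((Matrix.single i j 1 - Matrix.single j i 1 : Matrix n n ℝ) * (v α)ᵀ) =
        2 * v α i j := by
    have hji : v α j i = -v α i j := congrFun₂ (hskew α) i j
    simp only [Matrix.sub_mul, Matrix.trace_sub, Matrix.trace_single_mul,
      Matrix.transpose_apply, smul_eq_mul, hji]
    ring
  have hkl := congrFun₂ hX k l
  simp only [htr, Matrix.sub_apply, Matrix.sum_apply, Matrix.smul_apply, smul_eq_mul,
    Matrix.single_apply, mul_assoc, ← Finset.mul_sum] at hkl
  linarith

/-- Sandwiching a matrix by an orthonormal basis of the skew-symmetric matrices. -/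
lemma sum_mul_mul_of_orthonormal_skew {ι n : Type*} [Fintype ι] [DecidableEq ι]
    [Fintype n] [DecidableEq n] {v : ι → Matrix n n ℝ}
    (hskew : ∀ α, (v α)ᵀ = -(v α))
    (horth : ∀ α β, Matrix.trace (v α * (v β)ᵀ) = if α = β then 1 else 0)
    (hspan : ∀ X : Matrix n n ℝ, Xᵀ = -X → X ∈ Submodule.span ℝ (Set.range v))
    (M : Matrix n n ℝ) :
    ∑ α, v α * M * v α =
      (1 / 2 : ℝ) • Mᵀ - ((1 / 2) * Matrix.trace M) • (1 : Matrix n n ℝ) := by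
  ext i l
  have hcomm : (∑ α, v α * M * v α) i l = ∑ k, ∑ j, M j k * ∑ α, v α i j * v α k l := by
    simp only [Matrix.sum_apply, Matrix.mul_apply, Finset.sum_mul, Finset.mul_sum]
    rw [Finset.sum_comm]
    refine Finset.sum_congr rfl fun k _ => ?_
    rw [Finset.sum_comm]
    exact Finset.sum_congr rfl fun j _ => Finset.sum_congr rfl fun α _ => by ring
  simp only [hcomm, sum_apply_mul_apply_of_orthonormal_skew hskew horth hspan, mul_sub,
    Finset.sum_sub_distrib, ite_and, Matrix.sub_apply, Matrix.smul_apply, smul_eq_mul,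
    Matrix.transpose_apply, Matrix.one_apply, Matrix.trace, Matrix.diag_apply]
  by_cases h : i = l <;> simp [h, Finset.mul_sum, mul_comm]

/-- **Magic formula for `so(N)`.**  For every `N ≥ 2`, every orthonormal basis
`(v_α)_{α = 1, …, N(N−1)/2}` of the space of skew-symmetric real `N × N` matrices with
respect to the inner product `⟨X, Y⟩ = Tr (X Yᵀ)` (orthonormality together with spanning),
and every real `N × N` matrix `M`, one has
`Σ_α v_α M v_α = (1/2) Mᵀ − (1/2) Tr(M) I_N`; in particular, taking `M = I_N`,
`Σ_α v_α² = −((N−1)/2) I_N`. -/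
theorem so_magic_formula (N : ℕ) (hN : 2 ≤ N)
    (v : Fin (N * (N - 1) / 2) → Matrix (Fin N) (Fin N) ℝ)
    (hskew : ∀ α, (v α)ᵀ = -(v α))
    (horth : ∀ α β, Matrix.trace (v α * (v β)ᵀ) = if α = β then 1 else 0)
    (hspan : ∀ X : Matrix (Fin N) (Fin N) ℝ, Xᵀ = -X →
      X ∈ Submodule.span ℝ (Set.range v))
    (M : Matrix (Fin N) (Fin N) ℝ) :
    ∑ α, v α * M * v α
        = (1 / 2 : ℝ) • Mᵀ - ((1 / 2) * Matrix.trace M) • (1 : Matrix (Fin N) (Fin N) ℝ)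
      ∧ ∑ α, v α * v α = (-(((N : ℝ) - 1) / 2)) • (1 : Matrix (Fin N) (Fin N) ℝ) := by
  have hsum := sum_mul_mul_of_orthonormal_skew hskew horth hspan
  refine ⟨hsum M, ?_⟩
  have hone := hsum 1
  simp only [Matrix.mul_one, Matrix.transpose_one, Matrix.trace_one, Fintype.card_fin,
    ← sub_smul] at hone
  rw [hone]
  congr 1
  ring
end

section
/- Magic formula for u(N): for every N ≥ 1, every orthonormal basis (v_α)_{α=1, …, N²} of u(N) viewed as a real vector space with the inner product ⟨X, Y⟩ = Re Tr(X Y*), and every complex N×N matrix M, one has Σ_α v_α M v_α = −Tr(M) I_N. In particular (taking M = I_N), Σ_α v_α² = −N I_N. -/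
open Matrix

/-- The trace of a product of two skew-Hermitian matrices is real. -/
theorem trace_mul_im_eq_zero_of_skew {n : Type*} [Fintype n] {X Y : Matrix n n ℂ}
    (hX : Xᴴ = -X) (hY : Yᴴ = -Y) : (trace (X * Y)).im = 0 := by
  have h : star (trace (X * Y)) = trace (X * Y) := by
    rw [← trace_conjTranspose, conjTranspose_mul, hX, hY, neg_mul_neg, trace_mul_comm]
  exact Complex.conj_eq_iff_im.mp h

/-- Expansion of an arbitrary complex matrix in an orthonormal basis of the space of
skew-Hermitian matrices. -/
theorem sum_trace_mul_smul_eq_neg {n ι : Type*} [Fintype n] [Fintype ι] [DecidableEq ι]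
    {v : ι → Matrix n n ℂ} (hskew : ∀ α, (v α)ᴴ = -(v α))
    (horth : ∀ α β, (trace (v α * (v β)ᴴ)).re = if α = β then 1 else 0)
    (hspan : ∀ X : Matrix n n ℂ, Xᴴ = -X → X ∈ Submodule.span ℝ (Set.range v))
    (X : Matrix n n ℂ) : ∑ α, trace (X * v α) • v α = -X := by
  have hskewX (X : Matrix n n ℂ) (hX : Xᴴ = -X) : ∑ α, trace (X * v α) • v α = -X := by
    replace hX := hspan X hX
    induction hX using Submodule.span_induction with
    | mem x hx =>
      obtain ⟨β, rfl⟩ := hx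
      have htr (α : ι) : trace (v β * v α) = if β = α then -1 else 0 := by
        have h := horth β α
        rw [hskew, mul_neg, trace_neg, Complex.neg_re] at h
        apply Complex.ext
        · rw [neg_eq_iff_eq_neg.mp h]
          split_ifs <;> simp
        · rw [trace_mul_im_eq_zero_of_skew (hskew β) (hskew α)]
          split_ifs <;> simp
      simp [htr]
    | zero => simp
    | add x y _ _ hx hy =>
      simp only [add_mul, trace_add, add_smul, Finset.sum_add_distrib, hx, hy, neg_add]
    | smul a x _ hx =>
      simp only [smul_mul_assoc, trace_smul, smul_assoc, ← Finset.smul_sum, hx, smul_neg]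
  have hlin (c : ℂ) (Y : Matrix n n ℂ) (hY : Yᴴ = -Y) :
      ∑ α, trace ((c • Y) * v α) • v α = -(c • Y) := by
    simp only [smul_mul_assoc, trace_smul, smul_assoc, ← Finset.smul_sum, hskewX Y hY, smul_neg]
  have hdecomp : X = (1 / 2 : ℂ) • (X - Xᴴ) + (-Complex.I / 2) • (Complex.I • (X + Xᴴ)) := by
    rw [smul_smul, show -Complex.I / 2 * Complex.I = 1 / 2 by
      rw [div_mul_eq_mul_div, neg_mul, Complex.I_mul_I, neg_neg], ← smul_add,
      sub_add_add_cancel, ← two_smul ℂ X, smul_smul]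
    norm_num
  have hsub := hlin (1 / 2) (X - Xᴴ) (by simp)
  have hadd := hlin (-Complex.I / 2) (Complex.I • (X + Xᴴ)) (by simp [add_comm])
  rw [hdecomp]
  simp only [add_mul, trace_add, add_smul, Finset.sum_add_distrib, neg_add] at hsub hadd ⊢
  rw [hsub, hadd]

/-- Completeness relation for the entries of an orthonormal basis of the space of
skew-Hermitian matrices. -/
theorem sum_apply_mul_apply_eq {n ι : Type*} [Fintype n] [DecidableEq n] [Fintype ι]
    [DecidableEq ι] {v : ι → Matrix n n ℂ} (hskew : ∀ α, (v α)ᴴ = -(v α))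
    (horth : ∀ α β, (trace (v α * (v β)ᴴ)).re = if α = β then 1 else 0)
    (hspan : ∀ X : Matrix n n ℂ, Xᴴ = -X → X ∈ Submodule.span ℝ (Set.range v))
    (a b c d : n) : ∑ α, v α a c * v α d b = if c = d ∧ a = b then -1 else 0 := by
  have h := congrFun₂ (sum_trace_mul_smul_eq_neg hskew horth hspan (single c a 1)) d b
  simp only [Matrix.sum_apply, Matrix.smul_apply, smul_eq_mul, Matrix.neg_apply, single_apply,
    trace_single_mul, one_mul] at h
  rw [h]
  split_ifs <;> simp

/-- The magic formula for an orthonormal basis with an arbitrary finite index type. -/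
theorem sum_mul_mul_eq_neg_trace_smul_one {n ι : Type*} [Fintype n] [DecidableEq n] [Fintype ι]
    [DecidableEq ι] {v : ι → Matrix n n ℂ} (hskew : ∀ α, (v α)ᴴ = -(v α))
    (horth : ∀ α β, (trace (v α * (v β)ᴴ)).re = if α = β then 1 else 0)
    (hspan : ∀ X : Matrix n n ℂ, Xᴴ = -X → X ∈ Submodule.span ℝ (Set.range v))
    (M : Matrix n n ℂ) : ∑ α, v α * M * v α = -(trace M) • (1 : Matrix n n ℂ) := by
  ext a b
  calc (∑ α, v α * M * v α) a b = ∑ d, ∑ c, M c d * ∑ α, v α a c * v α d b := by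
        simp only [Matrix.sum_apply, mul_apply, Finset.sum_mul, Finset.mul_sum]
        rw [Finset.sum_comm]
        refine Finset.sum_congr rfl fun d _ => ?_
        rw [Finset.sum_comm]
        refine Finset.sum_congr rfl fun c _ => Finset.sum_congr rfl fun α _ => ?_
        ring
    _ = (-(trace M) • (1 : Matrix n n ℂ)) a b := by
        simp only [sum_apply_mul_apply_eq hskew horth hspan]
        by_cases hab : a = b <;> simp [hab, trace]

/-- **Magic formula for `u(N)`.**  For every `N ≥ 1`, every orthonormal basis
`(v_α)_{α = 1, …, N²}` of the space of skew-Hermitian complex `N × N` matrices, viewed as a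
real vector space with the inner product `⟨X, Y⟩ = Re Tr (X Y*)` (orthonormality together
with real spanning), and every complex `N × N` matrix `M`, one has
`Σ_α v_α M v_α = −Tr(M) I_N`; in particular, taking `M = I_N`, `Σ_α v_α² = −N I_N`. -/
theorem u_magic_formula (N : ℕ) (hN : 1 ≤ N)
    (v : Fin (N ^ 2) → Matrix (Fin N) (Fin N) ℂ)
    (hskew : ∀ α, (v α)ᴴ = -(v α))
    (horth : ∀ α β, (Matrix.trace (v α * (v β)ᴴ)).re = if α = β then 1 else 0)
    (hspan : ∀ X : Matrix (Fin N) (Fin N) ℂ, Xᴴ = -X →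
      X ∈ Submodule.span ℝ (Set.range v))
    (M : Matrix (Fin N) (Fin N) ℂ) :
    ∑ α, v α * M * v α = -(Matrix.trace M) • (1 : Matrix (Fin N) (Fin N) ℂ)
      ∧ ∑ α, v α * v α = (-(N : ℂ)) • (1 : Matrix (Fin N) (Fin N) ℂ) := by
  have h := sum_mul_mul_eq_neg_trace_smul_one hskew horth hspan
  exact ⟨h M, by simpa using h 1⟩
end

section
/- Magic formula for su(N): for every N ≥ 2, every orthonormal basis (v_α)_{α=1, …, N²−1} of su(N) viewed as a real vector space with the inner product ⟨X, Y⟩ = Re Tr(X Y*), and every complex N×N matrix M, one has Σ_α v_α M v_α = (1/N) M − Tr(M) I_N. In particular (taking M = I_N), Σ_α v_α² = −((N²−1)/N) I_N. -/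
open Matrix

namespace Matrix

variable {n ι : Type*} [Fintype n] [Fintype ι]

/-- The trace of a product of two skew-Hermitian matrices is real. -/
lemma im_trace_mul_eq_zero_of_skewHermitian {X Y : Matrix n n ℂ} (hX : Xᴴ = -X) (hY : Yᴴ = -Y) :
    (trace (X * Y)).im = 0 := by
  have h : star (trace (X * Y)) = trace (X * Y) := by
    rw [← trace_conjTranspose, conjTranspose_mul, hX, hY, neg_mul_neg, trace_mul_comm]
  exact Complex.conj_eq_iff_im.1 h

/-- Expansion of an element of the real span of an orthonormal family of skew-Hermitian
matrices. -/
lemma sum_trace_mul_smul_of_mem_span [DecidableEq ι] {v : ι → Matrix n n ℂ}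
    (hskew : ∀ α, (v α)ᴴ = -(v α))
    (horth : ∀ α β, (trace (v α * (v β)ᴴ)).re = if α = β then 1 else 0)
    {X : Matrix n n ℂ} (hX : X ∈ Submodule.span ℝ (Set.range v)) :
    ∑ α, trace (X * v α) • v α = -X := by
  induction hX using Submodule.span_induction with
  | mem x hx =>
    obtain ⟨β, rfl⟩ := hx
    have key : ∀ α, trace (v β * v α) = if β = α then -1 else 0 := by
      intro α
      have h := horth β α
      rw [hskew α, mul_neg, trace_neg, Complex.neg_re] at h
      apply Complex.ext
      · split_ifs at h ⊢ <;> simp <;> linarith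
      · rw [im_trace_mul_eq_zero_of_skewHermitian (hskew β) (hskew α)]
        split_ifs <;> simp
    simp [key, ite_smul]
  | zero => simp
  | add x y _ _ hx hy =>
    simp only [add_mul, trace_add, add_smul, Finset.sum_add_distrib, hx, hy, neg_add]
  | smul r x _ hx =>
    simp only [smul_mul_assoc, trace_smul, smul_assoc, ← Finset.smul_sum, hx, smul_neg]

/-- Expansion of a traceless complex matrix in a real orthonormal basis of the traceless
skew-Hermitian matrices. -/
lemma sum_trace_mul_smul_of_trace_eq_zero [DecidableEq ι] {v : ι → Matrix n n ℂ}
    (hskew : ∀ α, (v α)ᴴ = -(v α))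
    (horth : ∀ α β, (trace (v α * (v β)ᴴ)).re = if α = β then 1 else 0)
    (hspan : ∀ X : Matrix n n ℂ, Xᴴ = -X → trace X = 0 → X ∈ Submodule.span ℝ (Set.range v))
    {Y : Matrix n n ℂ} (hY : trace Y = 0) :
    ∑ α, trace (Y * v α) • v α = -Y := by
  have hA := sum_trace_mul_smul_of_mem_span hskew horth
    (hspan (Y - Yᴴ) (by simp) (by simp [trace_conjTranspose, hY]))
  have hB := sum_trace_mul_smul_of_mem_span hskew horth
    (hspan (Complex.I • (Y + Yᴴ)) (by simp [add_comm]) (by simp [trace_conjTranspose, hY]))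
  simp only [smul_mul_assoc, trace_smul, smul_assoc, ← Finset.smul_sum] at hB
  rw [← smul_neg] at hB
  replace hB := smul_right_injective _ Complex.I_ne_zero hB
  have h2 : (2 : ℂ) • ∑ α, trace (Y * v α) • v α = (2 : ℂ) • -Y := by
    calc (2 : ℂ) • ∑ α, trace (Y * v α) • v α
        = ∑ α, trace ((Y - Yᴴ) * v α) • v α + ∑ α, trace ((Y + Yᴴ) * v α) • v α := by
          rw [Finset.smul_sum, ← Finset.sum_add_distrib]
          refine Finset.sum_congr rfl fun α _ => ?_
          rw [← add_smul, smul_smul, ← trace_add, ← add_mul, sub_add_add_cancel, add_mul,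
            trace_add, two_mul]
      _ = (2 : ℂ) • -Y := by rw [hA, hB, two_smul]; abel
  exact smul_right_injective _ two_ne_zero h2

/-- The completeness relation, entrywise, for a real orthonormal basis of the traceless
skew-Hermitian matrices. -/
lemma sum_apply_mul_apply_of_skewHermitian_basis [DecidableEq ι] [DecidableEq n] [Nonempty n]
    {v : ι → Matrix n n ℂ}
    (hskew : ∀ α, (v α)ᴴ = -(v α)) (htraceless : ∀ α, trace (v α) = 0)
    (horth : ∀ α β, (trace (v α * (v β)ᴴ)).re = if α = β then 1 else 0)
    (hspan : ∀ X : Matrix n n ℂ, Xᴴ = -X → trace X = 0 → X ∈ Submodule.span ℝ (Set.range v))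
    (i a b l : n) :
    ∑ α, v α i a * v α b l
      = (if a = i then 1 else 0) * (if b = l then 1 else 0) * (Fintype.card n : ℂ)⁻¹
        - (if a = b then 1 else 0) * (if i = l then 1 else 0) := by
  have hn : (Fintype.card n : ℂ) ≠ 0 := Nat.cast_ne_zero.2 Fintype.card_ne_zero
  set E : Matrix n n ℂ := single a i 1 with hE
  have htr : trace E = if a = i then 1 else 0 := by
    simp [hE, trace, single_apply, ite_and, eq_comm]
  have h := sum_trace_mul_smul_of_trace_eq_zero hskew horth hspan
    (Y := E - (trace E * (Fintype.card n : ℂ)⁻¹) • (1 : Matrix n n ℂ))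
    (by rw [trace_sub, trace_smul, trace_one, smul_eq_mul, mul_assoc, inv_mul_cancel₀ hn,
          mul_one, sub_self])
  have hc : ∀ α, trace ((E - (trace E * (Fintype.card n : ℂ)⁻¹) • (1 : Matrix n n ℂ)) * v α)
      = v α i a := by
    intro α
    rw [sub_mul, trace_sub, smul_mul_assoc, trace_smul, one_mul, htraceless, smul_zero, sub_zero,
      hE, trace_single_mul, one_smul]
  have he := congrFun (congrFun h b) l
  simp only [hc] at he
  simp only [sum_apply, smul_apply, smul_eq_mul, neg_apply, sub_apply, one_apply, htr] at he
  rw [he, hE, single_apply, ite_and]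
  split_ifs <;> ring

/-- The magic formula for a real orthonormal basis of the traceless skew-Hermitian matrices. -/
lemma sum_mul_mul_of_skewHermitian_basis [DecidableEq ι] [DecidableEq n] [Nonempty n]
    {v : ι → Matrix n n ℂ}
    (hskew : ∀ α, (v α)ᴴ = -(v α)) (htraceless : ∀ α, trace (v α) = 0)
    (horth : ∀ α β, (trace (v α * (v β)ᴴ)).re = if α = β then 1 else 0)
    (hspan : ∀ X : Matrix n n ℂ, Xᴴ = -X → trace X = 0 → X ∈ Submodule.span ℝ (Set.range v))
    (M : Matrix n n ℂ) :
    ∑ α, v α * M * v α = (Fintype.card n : ℂ)⁻¹ • M - trace M • (1 : Matrix n n ℂ) := by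
  ext i l
  calc (∑ α, v α * M * v α) i l
      = ∑ b, ∑ a, M a b * ∑ α, v α i a * v α b l := by
        simp only [sum_apply, mul_apply, Finset.sum_mul, Finset.mul_sum]
        rw [Finset.sum_comm]
        refine Finset.sum_congr rfl fun b _ => ?_
        rw [Finset.sum_comm]
        exact Finset.sum_congr rfl fun a _ => Finset.sum_congr rfl fun α _ => by ring
    _ = ((Fintype.card n : ℂ)⁻¹ • M - trace M • (1 : Matrix n n ℂ)) i l := by
        simp only [sum_apply_mul_apply_of_skewHermitian_basis hskew htraceless horth hspan,
          mul_sub, Finset.sum_sub_distrib]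
        congr 1
        · simp [mul_comm]
        · simp [trace, one_apply]

end Matrix

/-- **Magic formula for `su(N)`.**  For every `N ≥ 2`, every orthonormal basis
`(v_α)_{α = 1, …, N²−1}` of the space of traceless skew-Hermitian complex `N × N` matrices,
viewed as a real vector space with the inner product `⟨X, Y⟩ = Re Tr (X Y*)`
(orthonormality together with real spanning), and every complex `N × N` matrix `M`, one has
`Σ_α v_α M v_α = (1/N) M − Tr(M) I_N`; in particular, taking `M = I_N`,
`Σ_α v_α² = −((N²−1)/N) I_N`. -/
theorem su_magic_formula (N : ℕ) (hN : 2 ≤ N)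
    (v : Fin (N ^ 2 - 1) → Matrix (Fin N) (Fin N) ℂ)
    (hskew : ∀ α, (v α)ᴴ = -(v α))
    (htraceless : ∀ α, Matrix.trace (v α) = 0)
    (horth : ∀ α β, (Matrix.trace (v α * (v β)ᴴ)).re = if α = β then 1 else 0)
    (hspan : ∀ X : Matrix (Fin N) (Fin N) ℂ, Xᴴ = -X → Matrix.trace X = 0 →
      X ∈ Submodule.span ℝ (Set.range v))
    (M : Matrix (Fin N) (Fin N) ℂ) :
    ∑ α, v α * M * v α
        = ((N : ℂ))⁻¹ • M - (Matrix.trace M) • (1 : Matrix (Fin N) (Fin N) ℂ)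
      ∧ ∑ α, v α * v α = (-(((N : ℂ) ^ 2 - 1) / N)) • (1 : Matrix (Fin N) (Fin N) ℂ) := by
  have : Nonempty (Fin N) := ⟨⟨0, by omega⟩⟩
  have magic := sum_mul_mul_of_skewHermitian_basis hskew htraceless horth hspan
  simp only [Fintype.card_fin] at magic
  refine ⟨magic M, ?_⟩
  have hN0 : (N : ℂ) ≠ 0 := Nat.cast_ne_zero.2 (by omega)
  have h1 := magic 1
  simp only [mul_one, trace_one, Fintype.card_fin] at h1
  rw [h1, ← sub_smul]
  congr 1
  field_simp
  ring
end

section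
/- Trace magic formula for su(N): for every N ≥ 2, every orthonormal basis (v_α)_{α=1, …, N²−1} of su(N) viewed as a real vector space with the inner product ⟨X, Y⟩ = Re Tr(X Y*), and all complex N×N matrices M and P, one has Σ_α Tr(v_α M) Tr(v_α P) = (1/N) Tr(M) Tr(P) − Tr(M P). -/
open Matrix

namespace Matrix

variable {n ι : Type*} [Fintype n]

/-- The trace of a product of two skew-Hermitian matrices is real. -/
theorem trace_mul_im_eq_zero_of_skew {A B : Matrix n n ℂ} (hA : Aᴴ = -A) (hB : Bᴴ = -B) :
    (trace (A * B)).im = 0 := by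
  rw [← Complex.conj_eq_iff_im, starRingEnd_apply, ← trace_conjTranspose, conjTranspose_mul,
    hA, hB, neg_mul_neg, trace_mul_comm]

theorem trace_mul_eq_of_skew_orthonormal [DecidableEq ι] {v : ι → Matrix n n ℂ}
    (hskew : ∀ α, (v α)ᴴ = -(v α))
    (horth : ∀ α β, (trace (v α * (v β)ᴴ)).re = if α = β then 1 else 0) (α β : ι) :
    trace (v α * v β) = if α = β then -1 else 0 := by
  have h := horth α β
  rw [hskew β, mul_neg, trace_neg, Complex.neg_re] at h
  apply Complex.ext
  · rw [neg_eq_iff_eq_neg.mp h]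
    split_ifs <;> simp
  · rw [trace_mul_im_eq_zero_of_skew (hskew α) (hskew β)]
    split_ifs <;> simp

/-- Completeness relation for a skew-Hermitian orthonormal family, on its real span. -/
theorem sum_trace_mul_trace_of_mem_span [Fintype ι] [DecidableEq ι] {v : ι → Matrix n n ℂ}
    (hskew : ∀ α, (v α)ᴴ = -(v α))
    (horth : ∀ α β, (trace (v α * (v β)ᴴ)).re = if α = β then 1 else 0)
    {X : Matrix n n ℂ} (hX : X ∈ Submodule.span ℝ (Set.range v)) (P : Matrix n n ℂ) :
    ∑ α, trace (v α * X) * trace (v α * P) = -trace (X * P) := by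
  induction hX using Submodule.span_induction with
  | mem x hx =>
    obtain ⟨β, rfl⟩ := hx
    simp [trace_mul_eq_of_skew_orthonormal hskew horth]
  | zero => simp
  | add x y _ _ hx hy =>
    simp only [mul_add, add_mul, trace_add, Finset.sum_add_distrib, hx, hy, neg_add]
  | smul c x _ hx =>
    simp only [mul_smul_comm, smul_mul_assoc, trace_smul, ← Finset.smul_sum, hx, smul_neg]

/-- Completeness relation for an orthonormal basis of the traceless skew-Hermitian matrices,
on all traceless complex matrices. -/
theorem sum_trace_mul_trace_of_trace_eq_zero [Fintype ι] [DecidableEq ι]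
    {v : ι → Matrix n n ℂ}
    (hskew : ∀ α, (v α)ᴴ = -(v α))
    (horth : ∀ α β, (trace (v α * (v β)ᴴ)).re = if α = β then 1 else 0)
    (hspan : ∀ X : Matrix n n ℂ, Xᴴ = -X → trace X = 0 → X ∈ Submodule.span ℝ (Set.range v))
    {M : Matrix n n ℂ} (hM : trace M = 0) (P : Matrix n n ℂ) :
    ∑ α, trace (v α * M) * trace (v α * P) = -trace (M * P) := by
  have hA := sum_trace_mul_trace_of_mem_span hskew horth
    (hspan (M - Mᴴ) (by simp) (by simp [trace_conjTranspose, hM])) P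
  have hB := sum_trace_mul_trace_of_mem_span hskew horth
    (hspan (Complex.I • (M + Mᴴ)) (by simp [add_comm])
      (by simp [trace_conjTranspose, hM])) P
  simp only [mul_smul_comm, smul_mul_assoc, trace_smul, smul_eq_mul, mul_assoc,
    ← Finset.mul_sum, ← mul_neg] at hB
  have hB' := mul_left_cancel₀ Complex.I_ne_zero hB
  simp only [mul_add, add_mul, trace_add, Finset.sum_add_distrib] at hB'
  simp only [mul_sub, sub_mul, trace_sub, Finset.sum_sub_distrib] at hA
  linear_combination (hA + hB') / 2

end Matrix

/-- **Trace magic formula for `su(N)`.**  For every `N ≥ 2`, every orthonormal basis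
`(v_α)_{α = 1, …, N²−1}` of the space of traceless skew-Hermitian complex `N × N` matrices,
viewed as a real vector space with the inner product `⟨X, Y⟩ = Re Tr (X Y*)`
(orthonormality together with real spanning), and all complex `N × N` matrices `M`, `P`,
one has `Σ_α Tr(v_α M) Tr(v_α P) = (1/N) Tr(M) Tr(P) − Tr(M P)`. -/
theorem su_trace_magic_formula (N : ℕ) (hN : 2 ≤ N)
    (v : Fin (N ^ 2 - 1) → Matrix (Fin N) (Fin N) ℂ)
    (hskew : ∀ α, (v α)ᴴ = -(v α))
    (htraceless : ∀ α, Matrix.trace (v α) = 0)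
    (horth : ∀ α β, (Matrix.trace (v α * (v β)ᴴ)).re = if α = β then 1 else 0)
    (hspan : ∀ X : Matrix (Fin N) (Fin N) ℂ, Xᴴ = -X → Matrix.trace X = 0 →
      X ∈ Submodule.span ℝ (Set.range v))
    (M P : Matrix (Fin N) (Fin N) ℂ) :
    ∑ α, Matrix.trace (v α * M) * Matrix.trace (v α * P)
      = ((N : ℂ))⁻¹ * Matrix.trace M * Matrix.trace P - Matrix.trace (M * P) := by
  have hN0 : (N : ℂ) ≠ 0 := Nat.cast_ne_zero.mpr (by omega)
  have h := Matrix.sum_trace_mul_trace_of_trace_eq_zero hskew horth hspan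
    (M := M - ((N : ℂ)⁻¹ * Matrix.trace M) • 1)
    (by simp [Matrix.trace_sub, Matrix.trace_smul]; field_simp; simp) P
  simp only [mul_sub, sub_mul, mul_smul_comm, smul_mul_assoc, mul_one, one_mul,
    Matrix.trace_sub, Matrix.trace_smul, htraceless, smul_eq_mul, mul_zero,
    sub_zero] at h
  rw [h]
  ring
end

section
/- Same-edge quadratic covariation identity for SO(N) (deterministic form of the martingale bracket identity underlying the SO(N) master loop equation): for every N ≥ 2, every Q ∈ SO(N), every orthonormal basis (v_α) of so(N) with respect to ⟨X, Y⟩ = Tr(X Yᵀ), and all real N×N matrices P and R, one has Σ_α Tr(v_α Q P v_α Q R) = (1/2) Tr(Pᵀ R) − (1/2) Tr(Q P) Tr(Q R). -/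
open Matrix

/-- Expansion of an element of the span of a family orthonormal for `Tr (X Yᵀ)`. -/
theorem sum_trace_smul_of_mem_span {n ι : Type*} [Fintype n] [Fintype ι] [DecidableEq ι]
    {v : ι → Matrix n n ℝ}
    (horth : ∀ α β, trace (v α * (v β)ᵀ) = if α = β then 1 else 0)
    {X : Matrix n n ℝ} (hX : X ∈ Submodule.span ℝ (Set.range v)) :
    ∑ α, trace (X * (v α)ᵀ) • v α = X := by
  induction hX using Submodule.span_induction with
  | mem x hx =>
    obtain ⟨β, rfl⟩ := hx
    simp [horth]
  | zero => simp
  | add x y _ _ hx hy =>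
    simp only [add_mul, trace_add, add_smul, Finset.sum_add_distrib, hx, hy]
  | smul a x _ hx =>
    simp only [smul_mul_assoc, trace_smul, smul_assoc, ← Finset.smul_sum, hx]

/-- Completeness relation for an orthonormal basis of the skew-symmetric matrices. -/
theorem sum_skew_apply_mul_apply {n ι : Type*} [Fintype n] [DecidableEq n] [Fintype ι]
    [DecidableEq ι] {v : ι → Matrix n n ℝ} (hskew : ∀ α, (v α)ᵀ = -(v α))
    (horth : ∀ α β, trace (v α * (v β)ᵀ) = if α = β then 1 else 0)
    (hspan : ∀ X : Matrix n n ℝ, Xᵀ = -X → X ∈ Submodule.span ℝ (Set.range v))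
    (i j k l : n) :
    ∑ α, v α i j * v α k l =
      (1 / 2) * ((1 : Matrix n n ℝ) i k * (1 : Matrix n n ℝ) j l
        - (1 : Matrix n n ℝ) i l * (1 : Matrix n n ℝ) j k) := by
  have hX : (single k l (1 : ℝ) - single l k 1)ᵀ = -(single k l (1 : ℝ) - single l k 1) := by
    simp
  have h := congrFun (congrFun (sum_trace_smul_of_mem_span horth (hspan _ hX)) i) j
  have ht (α : ι) :
      trace ((single k l (1 : ℝ) - single l k 1) * (v α)ᵀ) = 2 * v α k l := by
    have hlk : v α l k = -v α k l := congrFun (congrFun (hskew α) k) l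
    simp [sub_mul, trace_single_mul, hlk]
    ring
  simp only [ht, Matrix.sum_apply, Matrix.smul_apply, smul_eq_mul, Matrix.sub_apply,
    single_apply] at h
  have h2 : ∑ α, 2 * v α k l * v α i j = 2 * ∑ α, v α i j * v α k l := by
    rw [Finset.mul_sum]
    exact Finset.sum_congr rfl fun α _ => by ring
  rw [h2] at h
  have e (a b c d : n) : (if a = c ∧ b = d then (1 : ℝ) else 0)
      = (1 : Matrix n n ℝ) c a * (1 : Matrix n n ℝ) d b := by
    simp only [one_apply, ite_and, eq_comm (a := c), eq_comm (a := d)]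
    split_ifs <;> simp
  rw [e, e] at h
  linarith

/-- The sum `∑ v A v` over an orthonormal basis of the skew-symmetric
matrices. -/
theorem sum_skew_mul_mul_skew {n ι : Type*} [Fintype n] [DecidableEq n] [Fintype ι]
    [DecidableEq ι] {v : ι → Matrix n n ℝ} (hskew : ∀ α, (v α)ᵀ = -(v α))
    (horth : ∀ α β, trace (v α * (v β)ᵀ) = if α = β then 1 else 0)
    (hspan : ∀ X : Matrix n n ℝ, Xᵀ = -X → X ∈ Submodule.span ℝ (Set.range v))
    (A : Matrix n n ℝ) :
    ∑ α, v α * A * v α = (1 / 2 : ℝ) • (Aᵀ - trace A • (1 : Matrix n n ℝ)) := by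
  ext i l
  have h : (∑ α, v α * A * v α) i l = ∑ k, ∑ j, A j k * ∑ α, v α i j * v α k l := by
    simp only [Matrix.sum_apply, mul_apply, Finset.sum_mul, Finset.mul_sum]
    rw [Finset.sum_comm]
    refine Finset.sum_congr rfl fun k _ => ?_
    rw [Finset.sum_comm]
    exact Finset.sum_congr rfl fun j _ => Finset.sum_congr rfl fun α _ => by ring
  rw [h]
  simp only [sum_skew_apply_mul_apply hskew horth hspan, one_apply, Matrix.smul_apply,
    Matrix.sub_apply, transpose_apply, smul_eq_mul, mul_sub, Finset.sum_sub_distrib]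
  congr 1
  · simp [mul_comm]
  · simp [trace, Finset.mul_sum, mul_comm]

/-- **Same-edge quadratic covariation identity for `SO(N)`** (deterministic form of the
martingale bracket identity underlying the `SO(N)` master loop equation): for every
`N ≥ 2`, every `Q ∈ SO(N)`, every orthonormal basis `(v_α)` of the skew-symmetric real
`N × N` matrices with respect to `⟨X, Y⟩ = Tr (X Yᵀ)` (orthonormality together with
spanning), and all real `N × N` matrices `P`, `R`, one has
`Σ_α Tr(v_α Q P v_α Q R) = (1/2) Tr(Pᵀ R) − (1/2) Tr(Q P) Tr(Q R)`. -/
theorem so_same_edge_covariation (N : ℕ) (hN : 2 ≤ N)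
    (Q : Matrix (Fin N) (Fin N) ℝ) (hQorth : Qᵀ * Q = 1) (hQdet : Q.det = 1)
    (v : Fin (N * (N - 1) / 2) → Matrix (Fin N) (Fin N) ℝ)
    (hskew : ∀ α, (v α)ᵀ = -(v α))
    (horth : ∀ α β, Matrix.trace (v α * (v β)ᵀ) = if α = β then 1 else 0)
    (hspan : ∀ X : Matrix (Fin N) (Fin N) ℝ, Xᵀ = -X →
      X ∈ Submodule.span ℝ (Set.range v))
    (P R : Matrix (Fin N) (Fin N) ℝ) :
    ∑ α, Matrix.trace (v α * Q * P * (v α * Q * R))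
      = (1 / 2) * Matrix.trace (Pᵀ * R)
        - (1 / 2) * Matrix.trace (Q * P) * Matrix.trace (Q * R) := by
  have h (α) : trace (v α * Q * P * (v α * Q * R))
      = trace (v α * (Q * P) * v α * (Q * R)) := by
    simp only [Matrix.mul_assoc]
  have hPR : Pᵀ * Qᵀ * (Q * R) = Pᵀ * R := by
    rw [Matrix.mul_assoc, ← Matrix.mul_assoc Qᵀ, hQorth, Matrix.one_mul]
  simp only [h]
  rw [← trace_sum, ← Finset.sum_mul, sum_skew_mul_mul_skew hskew horth hspan, smul_mul_assoc,
    sub_mul, smul_mul_assoc, Matrix.one_mul, transpose_mul, hPR, trace_smul, trace_sub,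
    trace_smul, smul_eq_mul, smul_eq_mul]
  ring
end
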